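/- arXiv:1012.1735 — 2 statements merged into one kernel-verified Lean document; each statement's English description precedes it below -/
import Mathlib

section
/- Let H and K be complex Hilbert spaces, δ > 0, and let t ↦ P_t be a map from (−δ, δ) to the bounded operators on H, continuous in the operator norm, such that each P_t is a projection (P_t² = P_t). Let S : H → K be a bounded linear operator. If the restriction S : P₀H → K is a bijection onto K, then there exists 0 < ε ≤ δ such that for every t with |t| < ε the restriction S : P_tH → K is a bijection onto K. -/
/-- A bounded operator that is bijective on the range of a bounded idempotent `p` has a bounded
inverse there. -/
theorem ContinuousLinearMap.exists_rightInverse_of_bijective_on_range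
    {𝕜 E F : Type*} [NontriviallyNormedField 𝕜] [NormedAddCommGroup E] [NormedSpace 𝕜 E]
    [CompleteSpace E] [NormedAddCommGroup F] [NormedSpace 𝕜 F] [CompleteSpace F]
    {p : E →L[𝕜] E} (hp : IsIdempotentElem p) (S : E →L[𝕜] F)
    (hS : Function.Bijective (fun x : Set.range p => S x.1)) :
    ∃ R : F →L[𝕜] E, S ∘L p ∘L R = 1 ∧ R ∘L S ∘L p = p := by
  have hpp (x : E) : p (p x) = p x := DFunLike.congr_fun hp x
  let M : Submodule 𝕜 E := (1 - p).ker
  have mem_M {x : E} : x ∈ M ↔ p x = x := by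
    rw [eq_comm, ← sub_eq_zero]
    rfl
  have : CompleteSpace M := (ContinuousLinearMap.isClosed_ker (1 - p)).completeSpace_coe
  let T : M →L[𝕜] F := S ∘L M.subtypeL
  have hinj : T.ker = ⊥ := by
    refine LinearMap.ker_eq_bot.2 fun x y hxy => Subtype.ext ?_
    have h := @hS.1 ⟨x, x, mem_M.1 x.2⟩ ⟨y, y, mem_M.1 y.2⟩ hxy
    exact Subtype.mk.inj h
  have hsurj : T.range = ⊤ := by
    refine LinearMap.range_eq_top.2 fun y => ?_
    obtain ⟨⟨_, x, rfl⟩, hx⟩ := hS.2 y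
    exact ⟨⟨p x, mem_M.2 (hpp x)⟩, hx⟩
  let e := ContinuousLinearEquiv.ofBijective T hinj hsurj
  refine ⟨M.subtypeL ∘L e.symm.toContinuousLinearMap, ?_, ?_⟩
  · ext y
    have h : p (e.symm y : E) = e.symm y := mem_M.1 (e.symm y).2
    change S (p (e.symm y : E)) = y
    rw [h]
    exact e.apply_symm_apply y
  · ext x
    exact congrArg Subtype.val (e.symm_apply_apply ⟨p x, mem_M.2 (hpp x)⟩)

open Topology in
/-- Bijectivity of a bounded operator on the range of a bounded idempotent is stable under
norm-small perturbations of the idempotent. -/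
theorem ContinuousLinearMap.eventually_bijective_on_range
    {𝕜 E F : Type*} [NontriviallyNormedField 𝕜] [NormedAddCommGroup E] [NormedSpace 𝕜 E]
    [CompleteSpace E] [NormedAddCommGroup F] [NormedSpace 𝕜 F] [CompleteSpace F]
    {p : E →L[𝕜] E} (hp : IsIdempotentElem p) (S : E →L[𝕜] F)
    (hS : Function.Bijective (fun x : Set.range p => S x.1)) :
    ∀ᶠ q : E →L[𝕜] E in 𝓝 p, IsIdempotentElem q →
      Function.Bijective (fun x : Set.range q => S x.1) := by
  obtain ⟨R, hSR, hRS⟩ := exists_rightInverse_of_bijective_on_range hp S hS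
  have hA : ∀ᶠ q in 𝓝 p, IsUnit (S ∘L q ∘L R) := by
    have hc : Continuous fun q : E →L[𝕜] E => S ∘L q ∘L R := by fun_prop
    exact hc.continuousAt.eventually (Units.isOpen.mem_nhds (by simp [hSR]))
  have hB : ∀ᶠ q in 𝓝 p, IsUnit (R ∘L S ∘L q + (1 - q)) := by
    have hc : Continuous fun q : E →L[𝕜] E => R ∘L S ∘L q + (1 - q) := by fun_prop
    exact hc.continuousAt.eventually (Units.isOpen.mem_nhds (by simp [hRS]))
  filter_upwards [hA, hB] with q hAq hBq hq
  have hqq (x : E) : q (q x) = q x := DFunLike.congr_fun hq x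
  constructor
  · rintro ⟨_, x, rfl⟩ ⟨_, y, rfl⟩ hxy
    obtain ⟨C, hC⟩ := hBq.exists_left_inv
    have hxy' : S (q x) = S (q y) := hxy
    have hBxy : (R ∘L S ∘L q + (1 - q)) (q x) = (R ∘L S ∘L q + (1 - q)) (q y) := by
      simp [hqq, hxy']
    have hCB (z : E) : C ((R ∘L S ∘L q + (1 - q)) z) = z := DFunLike.congr_fun hC z
    exact Subtype.ext ((hCB (q x)).symm.trans ((congrArg C hBxy).trans (hCB (q y))))
  · intro y
    obtain ⟨C, hC⟩ := hAq.exists_right_inv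
    exact ⟨⟨q (R (C y)), R (C y), rfl⟩, DFunLike.congr_fun hC y⟩

/-- **Stability of restricted invertibility under norm-continuous variation of
projections** (cf. Lemma 4.3 of Axelsson–Keith–McIntosh): if `S` restricted to the range
of `P₀` is a bijection onto `K`, then the same holds for the range of `P_t`
for all small `t`. -/
theorem restricted_invertibility_stable
    {H K : Type*} [NormedAddCommGroup H] [InnerProductSpace ℂ H] [CompleteSpace H]
    [NormedAddCommGroup K] [InnerProductSpace ℂ K] [CompleteSpace K]
    (δ : ℝ) (hδ : 0 < δ)
    (P : ℝ → (H →L[ℂ] H))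
    (hPcont : ContinuousOn P (Set.Ioo (-δ) δ))
    (hPproj : ∀ t ∈ Set.Ioo (-δ) δ, (P t).comp (P t) = P t)
    (S : H →L[ℂ] K)
    (hS0 : Function.Bijective (fun x : Set.range (⇑(P 0)) => S x.1)) :
    ∃ ε : ℝ, 0 < ε ∧ ε ≤ δ ∧
      ∀ t : ℝ, |t| < ε →
        Function.Bijective (fun x : Set.range (⇑(P t)) => S x.1) := by
  have h0 : (0 : ℝ) ∈ Set.Ioo (-δ) δ := ⟨neg_lt_zero.2 hδ, hδ⟩
  have hcont : ContinuousAt P 0 := hPcont.continuousAt (Ioo_mem_nhds h0.1 h0.2)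
  obtain ⟨η, hη, hball⟩ := Metric.eventually_nhds_iff.1
    (hcont.eventually (ContinuousLinearMap.eventually_bijective_on_range (hPproj 0 h0) S hS0))
  refine ⟨min η δ, lt_min hη hδ, min_le_right _ _, fun t ht => ?_⟩
  obtain ⟨htη, htδ⟩ := lt_min_iff.1 ht
  exact hball (by simpa using htη) (hPproj t (abs_lt.1 htδ))
end

section
/- The hat transform commutes with conjugation by J: let m ≥ 1 and let A = [[a, b],[c, d]] be a 2m×2m complex block matrix (m×m blocks) such that a is invertible and the Schur complement d − c a⁻¹ b is invertible (so that A is invertible and the conjugate matrix à := Jᵗ A⁻¹ J has invertible top-left block, where J = [[0, −I],[I, 0]]). Then Jᵗ Â J = (Ã)^, i.e. conjugating the transform of A by J yields the transform of the conjugate coefficient matrix of A. -/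
open scoped Matrix

/-- The hat transform of a `2×2`-block matrix `M` (with invertible top-left block):
`M^ = [[M⊥⊥⁻¹, −M⊥⊥⁻¹M⊥∥],[M∥⊥M⊥⊥⁻¹, M∥∥ − M∥⊥M⊥⊥⁻¹M⊥∥]]`. -/
noncomputable def hatMatrix {m : ℕ}
    (M : Matrix (Fin m ⊕ Fin m) (Fin m ⊕ Fin m) ℂ) :
    Matrix (Fin m ⊕ Fin m) (Fin m ⊕ Fin m) ℂ :=
  Matrix.fromBlocks
    (M.toBlocks₁₁)⁻¹
    (-((M.toBlocks₁₁)⁻¹ * M.toBlocks₁₂))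
    (M.toBlocks₂₁ * (M.toBlocks₁₁)⁻¹)
    (M.toBlocks₂₂ - M.toBlocks₂₁ * (M.toBlocks₁₁)⁻¹ * M.toBlocks₁₂)

/-- Conjugation of a block matrix by `J = [[0, −1],[1, 0]]`. -/
theorem J_transpose_mul_fromBlocks_mul_J {n R : Type*} [Fintype n] [DecidableEq n] [Ring R]
    (p q r s : Matrix n n R) :
    (Matrix.fromBlocks (0 : Matrix n n R) (-1) 1 0)ᵀ * Matrix.fromBlocks p q r s *
      Matrix.fromBlocks (0 : Matrix n n R) (-1) 1 0 = Matrix.fromBlocks s (-r) (-q) p := by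
  simp [Matrix.fromBlocks_transpose, Matrix.fromBlocks_multiply]

/-- The inverse of a block matrix in terms of the Schur complement of its top-left block. -/
theorem inv_fromBlocks_of_isUnit_schur {m n R : Type*} [Fintype m] [DecidableEq m]
    [Fintype n] [DecidableEq n] [CommRing R]
    (a : Matrix m m R) (b : Matrix m n R) (c : Matrix n m R) (d : Matrix n n R)
    (ha : IsUnit a) (hschur : IsUnit (d - c * a⁻¹ * b)) :
    (Matrix.fromBlocks a b c d)⁻¹ =
      Matrix.fromBlocks (a⁻¹ + a⁻¹ * b * (d - c * a⁻¹ * b)⁻¹ * c * a⁻¹)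
        (-(a⁻¹ * b * (d - c * a⁻¹ * b)⁻¹)) (-((d - c * a⁻¹ * b)⁻¹ * c * a⁻¹))
        (d - c * a⁻¹ * b)⁻¹ := by
  cases ha.nonempty_invertible
  rw [← Matrix.invOf_eq_nonsing_inv a] at hschur ⊢
  cases hschur.nonempty_invertible
  let := Matrix.fromBlocks₁₁Invertible a b c d
  simp_rw [← Matrix.invOf_eq_nonsing_inv, Matrix.invOf_fromBlocks₁₁_eq]

/-- **The hat transform commutes with conjugation by `J`:** for `A = [[a,b],[c,d]]` with
`a` and the Schur complement `d − ca⁻¹b` invertible, `Jᵗ Â J = (Ã)^` where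
`Ã = Jᵗ A⁻¹ J` is the conjugate coefficient matrix. -/
theorem hatTransform_conj_J
    (m : ℕ) (hm : 1 ≤ m)
    (a b c d : Matrix (Fin m) (Fin m) ℂ)
    (ha : IsUnit a) (hschur : IsUnit (d - c * a⁻¹ * b)) :
    (Matrix.fromBlocks (0 : Matrix (Fin m) (Fin m) ℂ) (-1) 1 0)ᵀ *
        hatMatrix (Matrix.fromBlocks a b c d) *
        Matrix.fromBlocks (0 : Matrix (Fin m) (Fin m) ℂ) (-1) 1 0 =
      hatMatrix
        ((Matrix.fromBlocks (0 : Matrix (Fin m) (Fin m) ℂ) (-1) 1 0)ᵀ *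
          (Matrix.fromBlocks a b c d)⁻¹ *
          Matrix.fromBlocks (0 : Matrix (Fin m) (Fin m) ℂ) (-1) 1 0) := by
  have hdet := (Matrix.isUnit_iff_isUnit_det _).mp hschur
  rw [inv_fromBlocks_of_isUnit_schur a b c d ha hschur, J_transpose_mul_fromBlocks_mul_J]
  simp only [hatMatrix, Matrix.toBlocks_fromBlocks₁₁, Matrix.toBlocks_fromBlocks₁₂,
    Matrix.toBlocks_fromBlocks₂₁, Matrix.toBlocks_fromBlocks₂₂]
  rw [J_transpose_mul_fromBlocks_mul_J, Matrix.nonsing_inv_nonsing_inv _ hdet]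
  simp only [neg_neg, Matrix.mul_assoc (a⁻¹ * b), Matrix.nonsing_inv_mul _ hdet, Matrix.mul_one]
  congr 1
  · rw [Matrix.mul_assoc _ c, Matrix.mul_nonsing_inv_cancel_left _ _ hdet]
  · simp only [Matrix.mul_assoc, add_sub_cancel_right]
end
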